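/- Let (x_i[n])_{i=1}^I and (x_i^inx[n])_{i=1}^I, n ≥ 0, be the sequences generated by the inexact NEXT algorithm under Assumptions A, F, B, with step sizes α[n] ∈ (0, 1], Σ_n α[n] = ∞, Σ_n α[n]² < ∞, and error sequences (ε_i[n])_n nonnegative, uniformly bounded, with Σ_n α[n] ε_i[n] < ∞ for every i. Then there exists a finite constant c > 0 such that ‖x_i^inx[n] − x_i[n]‖ ≤ c for all n ≥ 0 and all i = 1,…,I. -/

import Mathlib

open Filter
open scoped InnerProductSpace

/-- A finite convex function has a subgradient at every point. -/
theorem ConvexOn.exists_subgradient {E : Type*} [NormedAddCommGroup E] [InnerProductSpace ℝ E]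
    [FiniteDimensional ℝ E] {G : E → ℝ} (hG : ConvexOn ℝ Set.univ G) (x : E) :
    ∃ g : E, ∀ y, G x + ⟪g, y - x⟫_ℝ ≤ G y := by
  have hcont : Continuous G := continuousOn_univ.mp (hG.continuousOn isOpen_univ)
  have hconv : Convex ℝ {p : E × ℝ | G p.1 < p.2} := by
    simpa using hG.convex_strict_epigraph
  have hopen : IsOpen {p : E × ℝ | G p.1 < p.2} :=
    isOpen_lt (hcont.comp continuous_fst) continuous_snd
  obtain ⟨φ, hφ⟩ := geometric_hahn_banach_open_point hconv hopen
    (x := (x, G x)) (by simp)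
  let φ₁ : E →L[ℝ] ℝ := φ.comp (ContinuousLinearMap.inl ℝ E ℝ)
  set c : ℝ := φ (0, 1)
  have hsplit : ∀ p t, φ (p, t) = φ₁ p + t * c := by
    intro p t
    have : ((p, t) : E × ℝ) = (p, 0) + t • (0, 1) := by simp
    rw [this, map_add, map_smul, smul_eq_mul]
    rfl
  have hc : c < 0 := by
    have := hφ (x, G x + 1) (by simp)
    rw [hsplit, hsplit] at this
    linarith
  have hle : ∀ y, φ₁ y + G y * c ≤ φ₁ x + G x * c := by
    intro y
    have hlim : Tendsto (fun t : ℝ => φ₁ y + t * c) (nhdsWithin (G y) (Set.Ioi (G y)))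
        (nhds (φ₁ y + G y * c)) :=
      ((by fun_prop : Continuous fun t : ℝ => φ₁ y + t * c).tendsto _).mono_left
        nhdsWithin_le_nhds
    refine le_of_tendsto hlim ?_
    filter_upwards [self_mem_nhdsWithin] with t ht
    have := hφ (y, t) ht
    rw [hsplit, hsplit] at this
    exact this.le
  refine ⟨(-c)⁻¹ • (InnerProductSpace.toDual ℝ E).symm φ₁, fun y => ?_⟩
  have h := hle y
  rw [real_inner_smul_left, InnerProductSpace.toDual_symm_apply, map_sub]
  have : (-c)⁻¹ * (φ₁ y - φ₁ x) ≤ G y - G x := by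
    rw [inv_mul_le_iff₀ (by linarith)]
    linarith
  linarith

/-- First-order lower bound for a differentiable strongly convex function. -/
theorem StrongConvexOn.inner_gradient_add_le {E : Type*} [NormedAddCommGroup E]
    [InnerProductSpace ℝ E] [CompleteSpace E] {K : Set E} {τ : ℝ} {h : E → ℝ}
    (hh : StrongConvexOn K τ h) {x u g : E} (hx : x ∈ K) (hu : u ∈ K) (hg : HasGradientAt h g x) :
    h x + ⟪g, u - x⟫_ℝ + τ / 2 * ‖u - x‖ ^ 2 ≤ h u := by
  have hline : HasDerivAt (fun t : ℝ => x + t • (u - x)) (u - x) 0 := by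
    simpa using ((hasDerivAt_id (0 : ℝ)).smul_const (u - x)).const_add x
  have hder : HasDerivAt (fun t : ℝ => h (x + t • (u - x))) ⟪g, u - x⟫_ℝ 0 := by
    have hg' : HasFDerivAt h (InnerProductSpace.toDual ℝ E g) (x + (0 : ℝ) • (u - x)) := by
      simpa using hg.hasFDerivAt
    simpa [Function.comp_def] using hg'.comp_hasDerivAt (0 : ℝ) hline
  have hlim := hder.tendsto_slope_zero_right
  have hlim' : Tendsto (fun t : ℝ => h u - h x - (1 - t) * (τ / 2 * ‖u - x‖ ^ 2))
      (nhdsWithin 0 (Set.Ioi 0)) (nhds (h u - h x - (1 - 0) * (τ / 2 * ‖u - x‖ ^ 2))) :=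
    ((by fun_prop : Continuous fun t : ℝ =>
      h u - h x - (1 - t) * (τ / 2 * ‖u - x‖ ^ 2)).tendsto _).mono_left nhdsWithin_le_nhds
  have := le_of_tendsto_of_tendsto hlim hlim' (by
    filter_upwards [Ioo_mem_nhdsGT (zero_lt_one : (0 : ℝ) < 1)] with t ht
    have hsc := hh.2 hx hu (sub_nonneg.2 ht.2.le) ht.1.le (sub_add_cancel 1 t)
    have hpt : (1 - t) • x + t • u = x + t • (u - x) := by module
    rw [hpt, norm_sub_rev x u] at hsc
    simp only [smul_eq_mul] at hsc
    simp only [zero_add, zero_smul, add_zero, smul_eq_mul]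
    rw [inv_mul_le_iff₀ ht.1]
    nlinarith)
  linarith

/-- A minimizer of a strongly convex function plus a convex one is close to the point at which
all slopes are controlled. -/
theorem StrongConvexOn.norm_sub_le_of_le {E : Type*} [NormedAddCommGroup E]
    [InnerProductSpace ℝ E] [FiniteDimensional ℝ E] {K : Set E} {τ : ℝ} (hτ : 0 < τ) {h G : E → ℝ}
    (hh : StrongConvexOn K τ h) (hG : ConvexOn ℝ Set.univ G) {x u g p : E} {a b LG : ℝ}
    (hx : x ∈ K) (hu : u ∈ K) (hg : HasGradientAt h g x) (hga : ‖g‖ ≤ a) (hpb : ‖p‖ ≤ b)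
    (hsub : ∀ g, (∀ y, G x + ⟪g, y - x⟫_ℝ ≤ G y) → ‖g‖ ≤ LG)
    (hle : h u + ⟪p, u - x⟫_ℝ + G u ≤ h x + G x) :
    ‖u - x‖ ≤ 2 * (a + b + LG) / τ := by
  obtain ⟨γ, hγ⟩ := hG.exists_subgradient x
  have h1 := hh.inner_gradient_add_le hx hu hg
  have h2 := hγ u
  have key : ∀ {v : E} {r : ℝ}, ‖v‖ ≤ r → -(r * ‖u - x‖) ≤ ⟪v, u - x⟫_ℝ := fun {v r} hv =>
    (neg_le_neg (mul_le_mul_of_nonneg_right hv (norm_nonneg _))).trans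
      (neg_le_of_abs_le (abs_real_inner_le_norm v (u - x)))
  have h3 := key hga
  have h4 := key hpb
  have h5 := key (hsub γ hγ)
  rw [le_div_iff₀ hτ]
  rcases (norm_nonneg (u - x)).eq_or_lt with h0 | h0
  · have := (norm_nonneg g).trans hga
    have := (norm_nonneg p).trans hpb
    have := (norm_nonneg γ).trans (hsub γ hγ)
    rw [← h0]
    linarith
  · refine le_of_mul_le_mul_right ?_ h0
    nlinarith

/-- The product `W (s + k - 1) * ⋯ * W s` of consecutive weight matrices. -/
def transitionMatrix {ι : Type*} [Fintype ι] [DecidableEq ι] (W : ℕ → ι → ι → ℝ) (s : ℕ) :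
    ℕ → ι → ι → ℝ
  | 0 => fun i j => if i = j then 1 else 0
  | k + 1 => fun i j => ∑ l, W (s + k) i l * transitionMatrix W s k l j

namespace transitionMatrix

variable {ι : Type*} [Fintype ι] [DecidableEq ι] {W : ℕ → ι → ι → ℝ}

theorem nonneg (hW : ∀ n i j, 0 ≤ W n i j) (s k : ℕ) (i j : ι) :
    0 ≤ transitionMatrix W s k i j := by
  induction k generalizing i with
  | zero => simp only [transitionMatrix]; split_ifs <;> norm_num
  | succ k ih => exact Finset.sum_nonneg fun l _ => mul_nonneg (hW _ _ _) (ih l)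

theorem sum_row (hrow : ∀ n i, ∑ j, W n i j = 1) (s k : ℕ) (i : ι) :
    ∑ j, transitionMatrix W s k i j = 1 := by
  induction k generalizing i with
  | zero => simp [transitionMatrix]
  | succ k ih =>
    simp only [transitionMatrix]
    rw [Finset.sum_comm]
    simp_rw [← Finset.mul_sum, ih, mul_one, hrow]

theorem mul_le_succ (hW : ∀ n i j, 0 ≤ W n i j) (s k : ℕ) (i l j : ι) :
    W (s + k) i l * transitionMatrix W s k l j ≤ transitionMatrix W s (k + 1) i j :=
  Finset.single_le_sum (f := fun l => W (s + k) i l * transitionMatrix W s k l j)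
    (fun l _ => mul_nonneg (hW _ _ _) (nonneg hW s k l j)) (Finset.mem_univ l)

theorem pow_le_succ {θ : ℝ} (hθ : 0 ≤ θ) (hW : ∀ n i j, 0 ≤ W n i j) {s k : ℕ} {i l j : ι}
    (hil : θ ≤ W (s + k) i l) (h : θ ^ k ≤ transitionMatrix W s k l j) :
    θ ^ (k + 1) ≤ transitionMatrix W s (k + 1) i j := by
  refine le_trans ?_ (mul_le_succ hW s k i l j)
  rw [pow_succ']
  exact mul_le_mul hil h (pow_nonneg hθ _) (hW _ _ _)

theorem pow_le_of_le {θ : ℝ} (hθ : 0 ≤ θ) (hW : ∀ n i j, 0 ≤ W n i j)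
    (hdiag : ∀ n i, θ ≤ W n i i) {s k k' : ℕ} (hk : k ≤ k') {i j : ι}
    (h : θ ^ k ≤ transitionMatrix W s k i j) : θ ^ k' ≤ transitionMatrix W s k' i j := by
  induction k', hk using Nat.le_induction with
  | base => exact h
  | succ k' _ ih => exact pow_le_succ hθ hW (hdiag _ _) ih

/-- Along jointly connected blocks, the set of nodes reached from `j` grows until it is full. -/
theorem min_le_card_filter {θ : ℝ} (hθ : 0 ≤ θ) (hW : ∀ n i j, 0 ≤ W n i j)
    (hdiag : ∀ n i, θ ≤ W n i i) (hpos : ∀ n i j, 0 < W n i j → θ ≤ W n i j) {B : ℕ}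
    (hconn : ∀ k : ℕ, ∀ a b : ι, Relation.ReflTransGen
      (fun u v : ι => ∃ n ∈ Finset.Ico (k * B) ((k + 1) * B), 0 < W n v u) a b)
    (q p : ℕ) (j : ι) :
    min (Fintype.card ι) (p + 1) ≤
      (Finset.univ.filter fun i => θ ^ (p * B) ≤ transitionMatrix W (q * B) (p * B) i j).card := by
  have hmono : ∀ p, (Finset.univ.filter fun i =>
      θ ^ (p * B) ≤ transitionMatrix W (q * B) (p * B) i j) ⊆ Finset.univ.filter fun i =>
      θ ^ ((p + 1) * B) ≤ transitionMatrix W (q * B) ((p + 1) * B) i j := by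
    intro p i
    simp only [Finset.mem_filter, Finset.mem_univ, true_and]
    exact pow_le_of_le hθ hW hdiag (Nat.mul_le_mul_right B p.le_succ)
  have hmem : ∀ p, j ∈ Finset.univ.filter fun i =>
      θ ^ (p * B) ≤ transitionMatrix W (q * B) (p * B) i j := by
    intro p
    simp only [Finset.mem_filter, Finset.mem_univ, true_and]
    exact pow_le_of_le hθ hW hdiag (Nat.zero_le _) (by simp [transitionMatrix])
  induction p with
  | zero => exact (min_le_right _ _).trans (Finset.card_pos.2 ⟨j, hmem 0⟩)
  | succ p ih =>
    set S := Finset.univ.filter fun i => θ ^ (p * B) ≤ transitionMatrix W (q * B) (p * B) i j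
      with hS
    by_cases hfull : S = Finset.univ
    · have hcard : S.card = Fintype.card ι := by rw [hfull, Finset.card_univ]
      exact (min_le_left _ _).trans (hcard.ge.trans (Finset.card_le_card (hmono p)))
    obtain ⟨b, hb⟩ : ∃ b, b ∉ S := by
      by_contra! h
      exact hfull (Finset.eq_univ_iff_forall.2 h)
    obtain ⟨u, v, hu, hv, n, hn, hWn⟩ : ∃ u v, u ∈ S ∧ v ∉ S ∧
        ∃ n ∈ Finset.Ico ((q + p) * B) ((q + p + 1) * B), 0 < W n v u := by
      by_contra! h
      refine hb ?_
      clear hb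
      have hpath := hconn (q + p) j b
      induction hpath with
      | refl => exact hmem p
      | tail _ hstep ih' =>
        by_contra hv
        obtain ⟨n, hn, hlt⟩ := hstep
        exact absurd hlt (h _ _ ih' hv n hn).not_gt
    have hv' : v ∈ Finset.univ.filter fun i =>
        θ ^ ((p + 1) * B) ≤ transitionMatrix W (q * B) ((p + 1) * B) i j := by
      simp only [Finset.mem_filter, Finset.mem_univ, true_and]
      rw [Finset.mem_Ico] at hn
      obtain ⟨k, rfl⟩ : ∃ k, n = q * B + k := ⟨n - q * B, by
        have : (q + p) * B = q * B + p * B := by ring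
        omega⟩
      have h1 : p * B ≤ k := by
        have : (q + p) * B = q * B + p * B := by ring
        omega
      have h2 : k + 1 ≤ (p + 1) * B := by
        have : (q + p + 1) * B = q * B + (p + 1) * B := by ring
        omega
      refine pow_le_of_le hθ hW hdiag h2 (pow_le_succ hθ hW (hpos _ _ _ hWn) ?_)
      exact pow_le_of_le hθ hW hdiag h1 (by simpa [hS] using hu)
    have hcard := Finset.card_le_card (Finset.insert_subset hv' (hmono p))
    rw [Finset.card_insert_of_notMem hv] at hcard
    omega

theorem pow_le_block {θ : ℝ} (hθ : 0 ≤ θ) (hW : ∀ n i j, 0 ≤ W n i j)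
    (hdiag : ∀ n i, θ ≤ W n i i) (hpos : ∀ n i j, 0 < W n i j → θ ≤ W n i j) {B : ℕ}
    (hconn : ∀ k : ℕ, ∀ a b : ι, Relation.ReflTransGen
      (fun u v : ι => ∃ n ∈ Finset.Ico (k * B) ((k + 1) * B), 0 < W n v u) a b)
    (q : ℕ) (i j : ι) :
    θ ^ (Fintype.card ι * B) ≤ transitionMatrix W (q * B) (Fintype.card ι * B) i j := by
  have h := min_le_card_filter hθ hW hdiag hpos hconn q (Fintype.card ι) j
  rw [min_eq_left (Nat.le_succ _)] at h
  have := Finset.eq_univ_of_card _ (le_antisymm (Finset.card_le_univ _) h)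
  simpa using Finset.eq_univ_iff_forall.1 this i

end transitionMatrix

section Consensus

variable {ι E : Type*} [Fintype ι] [NormedAddCommGroup E] [NormedSpace ℝ E]

theorem norm_weighted_sum_le {w : ι → ℝ} (hw : ∀ i, 0 ≤ w i) {v : ι → E} {R : ℝ}
    (hv : ∀ i, ‖v i‖ ≤ R) : ‖∑ i, w i • v i‖ ≤ (∑ i, w i) * R := by
  rw [Finset.sum_mul]
  refine norm_sum_le_of_le _ fun i _ => ?_
  rw [norm_smul, Real.norm_of_nonneg (hw i)]
  exact mul_le_mul_of_nonneg_left (hv i) (hw i)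

variable [DecidableEq ι] {W : ℕ → ι → ι → ℝ} {y : ℕ → ι → E} {D : ℝ}

theorem norm_sub_transitionMatrix_le (hW : ∀ n i j, 0 ≤ W n i j)
    (hrow : ∀ n i, ∑ j, W n i j = 1)
    (hy : ∀ n i, ‖y (n + 1) i - ∑ j, W n i j • y n j‖ ≤ D) (s k : ℕ) (i : ι) :
    ‖y (s + k) i - ∑ j, transitionMatrix W s k i j • y s j‖ ≤ k * D := by
  induction k generalizing i with
  | zero => simp [transitionMatrix]
  | succ k ih =>
    have hsplit : y (s + (k + 1)) i - ∑ j, transitionMatrix W s (k + 1) i j • y s j =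
        (y (s + k + 1) i - ∑ j, W (s + k) i j • y (s + k) j) +
          ∑ l, W (s + k) i l • (y (s + k) l - ∑ j, transitionMatrix W s k l j • y s j) := by
      simp only [transitionMatrix, smul_sub, Finset.sum_sub_distrib, Finset.sum_smul,
        Finset.smul_sum, mul_smul]
      rw [Finset.sum_comm (s := Finset.univ) (t := Finset.univ)
        (f := fun j l => W (s + k) i l • transitionMatrix W s k l j • y s j), ← add_assoc s k 1]
      abel
    rw [hsplit]
    refine (norm_add_le_of_le (hy _ _) (norm_weighted_sum_le (hW _ _) ih)).trans ?_
    rw [hrow]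
    push_cast
    linarith

/-- Consensus iterations with bounded perturbations and bounded sum stay bounded. -/
theorem exists_norm_le_of_perturbed_consensus {θ : ℝ} (hθ : 0 < θ)
    (hW : ∀ n i j, 0 ≤ W n i j) (hrow : ∀ n i, ∑ j, W n i j = 1)
    (hdiag : ∀ n i, θ ≤ W n i i) (hpos : ∀ n i j, 0 < W n i j → θ ≤ W n i j) {B : ℕ} (hB : 0 < B)
    (hconn : ∀ k : ℕ, ∀ a b : ι, Relation.ReflTransGen
      (fun u v : ι => ∃ n ∈ Finset.Ico (k * B) ((k + 1) * B), 0 < W n v u) a b)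
    (hD : 0 ≤ D) (hy : ∀ n i, ‖y (n + 1) i - ∑ j, W n i j • y n j‖ ≤ D)
    {S : ℝ} (hS : ∀ n, ‖∑ j, y n j‖ ≤ S) : ∃ C, ∀ n i, ‖y n i‖ ≤ C := by
  rcases isEmpty_or_nonempty ι with hι | hι
  · exact ⟨0, fun _ i => hι.elim i⟩
  set N := Fintype.card ι
  have hNpos : 0 < N := Fintype.card_pos
  set T := N * B
  have hT : 0 < T := Nat.mul_pos hNpos hB
  set η := θ ^ T
  have hη : 0 < η := pow_pos hθ _
  have hNη : 0 < N * η := mul_pos (Nat.cast_pos.2 hNpos) hη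
  set R := max (∑ i, ‖y 0 i‖) ((η * S + T * D) / (N * η))
  have hRle : η * S + T * D ≤ R * (N * η) := (div_le_iff₀ hNη).1 (le_max_right _ _)
  have hR0 : 0 ≤ R := (Finset.sum_nonneg fun i _ => norm_nonneg _).trans (le_max_left _ _)
  have hblock : ∀ q i, ‖y (q * T) i‖ ≤ R := by
    intro q
    induction q with
    | zero =>
      intro i
      rw [zero_mul]
      exact (Finset.single_le_sum (f := fun i => ‖y 0 i‖) (fun i _ => norm_nonneg _)
        (Finset.mem_univ i)).trans (le_max_left _ _)
    | succ q ih =>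
      intro i
      have hlow : ∀ j, 0 ≤ transitionMatrix W (q * T) T i j - η := by
        intro j
        have := transitionMatrix.pow_le_block hθ.le hW hdiag hpos hconn (q * N) i j
        rw [mul_assoc] at this
        exact sub_nonneg.2 this
      have h1 := norm_sub_transitionMatrix_le hW hrow hy (q * T) T i
      have h2 := norm_weighted_sum_le hlow ih
      have h3 : ‖η • ∑ j, y (q * T) j‖ ≤ η * S := by
        rw [norm_smul, Real.norm_of_nonneg hη.le]
        exact mul_le_mul_of_nonneg_left (hS _) hη.le
      rw [Finset.sum_sub_distrib, transitionMatrix.sum_row hrow, Finset.sum_const,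
        Finset.card_univ, nsmul_eq_mul] at h2
      have hsplit : y ((q + 1) * T) i =
          (y (q * T + T) i - ∑ j, transitionMatrix W (q * T) T i j • y (q * T) j) +
          (∑ j, (transitionMatrix W (q * T) T i j - η) • y (q * T) j +
            η • ∑ j, y (q * T) j) := by
        simp only [sub_smul, Finset.sum_sub_distrib, Finset.smul_sum, add_mul, one_mul]
        abel
      rw [hsplit]
      refine (norm_add_le_of_le h1 (norm_add_le_of_le h2 h3)).trans ?_
      linarith
  refine ⟨R + T * D, fun n i => ?_⟩
  have hn : n / T * T + n % T = n := by rw [mul_comm]; exact Nat.div_add_mod n T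
  have h1 := norm_sub_transitionMatrix_le hW hrow hy (n / T * T) (n % T) i
  have h2 := norm_weighted_sum_le (transitionMatrix.nonneg hW (n / T * T) (n % T) i)
    (hblock (n / T))
  rw [transitionMatrix.sum_row hrow, one_mul] at h2
  rw [hn] at h1
  have h3 : ((n % T : ℕ) : ℝ) * D ≤ T * D :=
    mul_le_mul_of_nonneg_right (Nat.cast_le.2 (Nat.mod_lt n hT).le) hD
  have h4 := norm_add_le_of_le h1 h2
  rw [sub_add_cancel] at h4
  linarith

end Consensus

/-- Bounded disagreement in the inexact NEXT algorithm: `‖x_i^inx[n] − x_i[n]‖ ≤ c` uniformly. -/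
theorem stmt_11 {m I : ℕ} (hI : 0 < I)
    (K : Set (EuclideanSpace ℝ (Fin m)))
    (hKne : K.Nonempty) (hKcl : IsClosed K) (hKcv : Convex ℝ K)
    (f : Fin I → EuclideanSpace ℝ (Fin m) → ℝ)
    (gf : Fin I → EuclideanSpace ℝ (Fin m) → EuclideanSpace ℝ (Fin m))
    (Uo : Set (EuclideanSpace ℝ (Fin m))) (hUo : IsOpen Uo) (hKUo : K ⊆ Uo)
    (hdiff : ∀ i, ∀ x ∈ Uo, HasGradientAt (f i) (gf i x) x)
    (hgradcont : ∀ i, ContinuousOn (gf i) Uo)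
    (L : Fin I → ℝ)
    (hLip : ∀ i, ∀ x ∈ K, ∀ y ∈ K, ‖gf i x - gf i y‖ ≤ L i * ‖x - y‖)
    (LF : ℝ) (hLF : 0 < LF)
    (hgb : ∀ i, ∀ x ∈ K, ‖gf i x‖ ≤ LF)
    (G : EuclideanSpace ℝ (Fin m) → ℝ) (hG : ConvexOn ℝ Set.univ G)
    (LG : ℝ)
    (hsub : ∀ x ∈ K, ∀ g, (∀ y, G x + ⟪g, y - x⟫_ℝ ≤ G y) → ‖g‖ ≤ LG)
    (hcoer : ∀ c : ℝ, ∃ r : ℝ, ∀ x ∈ K, r ≤ ‖x‖ → c ≤ (∑ i, f i x) + G x)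
    (ft : Fin I → EuclideanSpace ℝ (Fin m) → EuclideanSpace ℝ (Fin m) → ℝ)
    (gft : Fin I → EuclideanSpace ℝ (Fin m) → EuclideanSpace ℝ (Fin m) → EuclideanSpace ℝ (Fin m))
    (τ : Fin I → ℝ) (hτ : ∀ i, 0 < τ i)
    (hF1 : ∀ i, ∀ z ∈ K, StrongConvexOn K (τ i) (fun x => ft i x z))
    (hftgrad : ∀ i, ∀ z ∈ K, ∀ x ∈ K, HasGradientAt (fun u => ft i u z) (gft i x z) x)
    (hF2 : ∀ i, ∀ x ∈ K, gft i x x = gf i x)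
    (Lt : ℝ)
    (hF3 : ∀ i, ∀ x ∈ K, ∀ w ∈ K, ∀ z ∈ K, ‖gft i x w - gft i x z‖ ≤ Lt * ‖w - z‖)
    (θ : ℝ) (hθ : θ ∈ Set.Ioo (0 : ℝ) 1)
    (W : ℕ → Fin I → Fin I → ℝ)
    (hWentries : ∀ n i j, W n i j = 0 ∨ W n i j ∈ Set.Icc θ 1)
    (hWdiag : ∀ n i, θ ≤ W n i i)
    (hWrow : ∀ n i, ∑ j, W n i j = 1)
    (hWcol : ∀ n j, ∑ i, W n i j = 1)
    (B : ℕ) (hB : 0 < B)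
    (hconn : ∀ k : ℕ, ∀ a b : Fin I,
      Relation.ReflTransGen
        (fun u v : Fin I => ∃ n ∈ Finset.Ico (k * B) ((k + 1) * B), 0 < W n v u) a b)
    (α : ℕ → ℝ) (hα : ∀ n, α n ∈ Set.Ioc (0 : ℝ) 1)
    (hαdiv : ¬ Summable α)
    (hαsq : Summable (fun n => (α n) ^ 2))
    (x xt y πt : Fin I → ℕ → EuclideanSpace ℝ (Fin m))
    (hx0 : ∀ i, x i 0 ∈ K)
    (hy0 : ∀ i, y i 0 = gf i (x i 0))
    (hπt : ∀ i n, πt i n = (I : ℝ) • y i n - gf i (x i n))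
    (hxt : ∀ i n, xt i n ∈ K ∧ ∀ u ∈ K, u ≠ xt i n →
      ft i (xt i n) (x i n) + ⟪πt i n, xt i n - x i n⟫_ℝ + G (xt i n)
        < ft i u (x i n) + ⟪πt i n, u - x i n⟫_ℝ + G u)
    (hyrec : ∀ i n, y i (n + 1) = (∑ j, W n i j • y j n) + gf i (x i (n + 1)) - gf i (x i n))
    (ε : Fin I → ℕ → ℝ) (hεnn : ∀ i n, 0 ≤ ε i n)
    (hεbd : ∃ Cb : ℝ, ∀ i n, ε i n ≤ Cb)
    (hεsum : ∀ i, Summable (fun n => α n * ε i n))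
    (xinx : Fin I → ℕ → EuclideanSpace ℝ (Fin m))
    (hinx : ∀ i n, xinx i n ∈ K ∧ ‖xinx i n - xt i n‖ ≤ ε i n)
    (hxrec : ∀ i n, x i (n + 1) = ∑ j, W n i j • (x j n + α n • (xinx j n - x j n))) :
    ∃ c : ℝ, 0 < c ∧ ∀ i, ∀ n : ℕ, ‖xinx i n - x i n‖ ≤ c := by
  have hW : ∀ n i j, 0 ≤ W n i j := fun n i j =>
    (hWentries n i j).elim (fun h => h.ge) fun h => hθ.1.le.trans h.1
  have hpos : ∀ n i j, 0 < W n i j → θ ≤ W n i j := fun n i j h =>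
    (hWentries n i j).elim (fun h0 => absurd h0 h.ne') fun h => h.1
  have hxK : ∀ n i, x i n ∈ K := by
    intro n
    induction n with
    | zero => exact hx0
    | succ n ih =>
      intro i
      rw [hxrec]
      refine hKcv.sum_mem (fun j _ => hW n i j) (hWrow n i) fun j _ => ?_
      exact hKcv.add_smul_sub_mem (ih j) (hinx j n).1 ⟨(hα n).1.le, (hα n).2⟩
  have hysum : ∀ n, ∑ i, y i n = ∑ i, gf i (x i n) := by
    intro n
    induction n with
    | zero => exact Finset.sum_congr rfl fun i _ => hy0 i
    | succ n ih =>
      simp_rw [hyrec, Finset.sum_sub_distrib, Finset.sum_add_distrib]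
      rw [Finset.sum_comm]
      simp_rw [← Finset.sum_smul, hWcol, one_smul, ih]
      abel
  obtain ⟨C, hC⟩ := exists_norm_le_of_perturbed_consensus (y := fun n i => y i n)
    (D := LF + LF) (S := I * LF) hθ.1 hW hWrow hWdiag hpos hB hconn (by positivity)
    (fun n i => by
      rw [hyrec, add_sub_assoc, add_sub_cancel_left]
      exact norm_sub_le_of_le (hgb i _ (hxK _ i)) (hgb i _ (hxK _ i)))
    (fun n => by
      rw [hysum]
      refine (norm_sum_le_of_le _ fun i _ => hgb i _ (hxK n i)).trans ?_
      simp)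
  have hπ : ∀ i n, ‖πt i n‖ ≤ I * C + LF := by
    intro i n
    rw [hπt]
    refine norm_sub_le_of_le ?_ (hgb i _ (hxK n i))
    rw [norm_smul, Real.norm_natCast]
    exact mul_le_mul_of_nonneg_left (hC n i) (Nat.cast_nonneg _)
  have hdist : ∀ i n, ‖xt i n - x i n‖ ≤ 2 * (LF + (I * C + LF) + LG) / τ i := by
    intro i n
    have hK := hxK n i
    refine (hF1 i _ hK).norm_sub_le_of_le (hτ i) hG hK (hxt i n).1 (hftgrad i _ hK _ hK) ?_
      (hπ i n) (hsub _ hK) ?_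
    · rw [hF2 i _ hK]
      exact hgb i _ hK
    · by_cases h : x i n = xt i n
      · simp [← h]
      · simpa using ((hxt i n).2 _ hK h).le
  obtain ⟨Cb, hCb⟩ := hεbd
  obtain ⟨M, hM⟩ := (Set.finite_range fun i => 2 * (LF + (I * C + LF) + LG) / τ i).bddAbove
  refine ⟨max 1 (Cb + M), by positivity, fun i n => le_max_of_le_right ?_⟩
  rw [← sub_add_sub_cancel (xinx i n) (xt i n) (x i n)]
  exact norm_add_le_of_le ((hinx i n).2.trans (hCb i n))
    ((hdist i n).trans (hM (Set.mem_range_self i)))
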